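/- Suppose there is an n ≥ 1 such that dim_K V(2^n) = 2 and V(2^{m+1}) = V(2^m)V(2^m) for all m ≥ n. Write V(2^n) = K·m_1 + K·m_2 with m_1, m_2 monomials of degree 2^n. Then the images of m_1 and m_2 in A/E generate a free subalgebra of A/E; in particular A/E contains a free noncommutative subalgebra on two generators that are images of monomials of the same degree. -/

import Mathlib

/-
Formalization of statements from:
"Golod-Shafarevich algebras of a reduced number of defining relations" (A. Smoktunowicz).

`FA K` is the free associative unital `K`-algebra `A = K⟨x,y⟩` on two generators
(`FreeAlgebra.ι K 0` and `FreeAlgebra.ι K 1`), graded with the generators in degree 1.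
-/

open scoped Pointwise Classical

noncomputable section

/-- The free associative unital `K`-algebra on two generators. -/
abbrev FA (K : Type) [Field K] : Type := FreeAlgebra K (Fin 2)

variable (K : Type) [Field K]

/-- The set of monomials of degree `k` in the free algebra on two generators. -/
def Mon (k : ℕ) : Set (FA K) :=
  { m | ∃ w : List (Fin 2), w.length = k ∧ m = (w.map (FreeAlgebra.ι K)).prod }

/-- `Adeg K k` is the `k`-th homogeneous component `A(k)`: the span of the monomials of
degree `k`. -/
def Adeg (k : ℕ) : Submodule K (FA K) :=
  Submodule.span K (Mon K k)

/-- Properties (1)-(4) of the families `U(2^m)`, `V(2^m)` of subspaces of `A(2^m)`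
(Section 1 of the paper):
(1) `V(2^m)` is spanned by monomials (of degree `2^m`);
(2) `V(2^m) + U(2^m) = A(2^m)` and `V(2^m) ∩ U(2^m) = 0`;
(3) `A(2^{m-1})U(2^{m-1}) + U(2^{m-1})A(2^{m-1}) ⊆ U(2^m)`;
(4) `V(2^m) ⊆ V(2^{m-1})V(2^{m-1})`;
with `V(2^0) = Kx + Ky` and `U(2^0) = 0`. -/
def UVCond (U V : ℕ → Submodule K (FA K)) : Prop :=
  V 0 = Submodule.span K {FreeAlgebra.ι K 0, FreeAlgebra.ι K 1} ∧
  U 0 = ⊥ ∧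
  ∀ m : ℕ, 1 ≤ m →
    (∃ s ⊆ Mon K (2 ^ m), V m = Submodule.span K s) ∧
    U m ≤ Adeg K (2 ^ m) ∧
    V m ⊔ U m = Adeg K (2 ^ m) ∧
    V m ⊓ U m = ⊥ ∧
    Adeg K (2 ^ (m - 1)) * U (m - 1) ⊔ U (m - 1) * Adeg K (2 ^ (m - 1)) ≤ U m ∧
    V m ≤ V (m - 1) * V (m - 1)

/-- The homogeneous component `E(k)` (as a set), for `k ≥ 1`.  For the unique `n` with
`2^(n-1) ≤ k < 2^n` (i.e. `n = Nat.log 2 k + 1`) it consists of those `r ∈ A(k)` with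
`A r A ∩ A(2^(n+1)) ⊆ U(2^n)A(2^n) + A(2^n)U(2^n)`; here `A r A` is the two-sided ideal
generated by `r`, realized as the subspace `⊤ * span{r} * ⊤`. -/
def ESet (U : ℕ → Submodule K (FA K)) (k : ℕ) : Set (FA K) :=
  { r | r ∈ Adeg K k ∧
    (⊤ : Submodule K (FA K)) * Submodule.span K {r} * ⊤ ⊓ Adeg K (2 ^ (Nat.log 2 k + 2)) ≤
      U (Nat.log 2 k + 1) * Adeg K (2 ^ (Nat.log 2 k + 1)) ⊔
        Adeg K (2 ^ (Nat.log 2 k + 1)) * U (Nat.log 2 k + 1) }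

/-- The graded subspace `E = ⊕_{k ≥ 1} E(k)` (each `E(k)` is a subspace, so the span of the
union of the `E(k)` is their direct sum). -/
def Esub (U : ℕ → Submodule K (FA K)) : Submodule K (FA K) :=
  Submodule.span K (⋃ k ∈ Set.Ici 1, ESet K U k)

/-- Auxiliary: the product of the `V(2^p)` over the set bits of `k`, lowest bit first,
with bit positions shifted by `i`. -/
def prodLow (V : ℕ → Submodule K (FA K)) (i k : ℕ) : Submodule K (FA K) :=
  if _h : k = 0 then 1
  else (if k % 2 = 1 then V i else 1) * prodLow V (i + 1) (k / 2)
termination_by k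
decreasing_by exact Nat.div_lt_self (Nat.pos_of_ne_zero _h) one_lt_two

/-- Auxiliary: the product of the `V(2^p)` over the set bits of `k`, highest bit first. -/
def prodHigh (V : ℕ → Submodule K (FA K)) (i k : ℕ) : Submodule K (FA K) :=
  if _h : k = 0 then 1
  else prodHigh V (i + 1) (k / 2) * (if k % 2 = 1 then V i else 1)
termination_by k
decreasing_by exact Nat.div_lt_self (Nat.pos_of_ne_zero _h) one_lt_two

/-- `V^<(k) = V(2^{p_1}) ⋯ V(2^{p_t})` where `k = 2^{p_1} + ⋯ + 2^{p_t}` in binary with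
`p_1 < ⋯ < p_t`; `V^<(0) = K·1`. -/
def Vlt (V : ℕ → Submodule K (FA K)) (k : ℕ) : Submodule K (FA K) := prodLow K V 0 k

/-- `V^>(k) = V(2^{p_t}) ⋯ V(2^{p_1})`; `V^>(0) = K·1`. -/
def Vgt (V : ℕ → Submodule K (FA K)) (k : ℕ) : Submodule K (FA K) := prodHigh K V 0 k

/-- `U^<(k) = Σ_i A(2^{p_1}+⋯+2^{p_{i-1}}) U(2^{p_i}) A(2^{p_{i+1}}+⋯+2^{p_t})`
(for each set bit `p_i` of `k`, the lower part of `k` is `k % 2^{p_i}` and the upper part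
is `k - k % 2^{p_i} - 2^{p_i}`); `U^<(0) = 0`. -/
def Ult (U : ℕ → Submodule K (FA K)) (k : ℕ) : Submodule K (FA K) :=
  ⨆ (p : ℕ) (_ : k.testBit p),
    Adeg K (k % 2 ^ p) * U p * Adeg K (k - k % 2 ^ p - 2 ^ p)

/-- `U^>(k) = Σ_i A(2^{p_t}+⋯+2^{p_{i+1}}) U(2^{p_i}) A(2^{p_{i-1}}+⋯+2^{p_1})`;
`U^>(0) = 0`. -/
def Ugt (U : ℕ → Submodule K (FA K)) (k : ℕ) : Submodule K (FA K) :=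
  ⨆ (p : ℕ) (_ : k.testBit p),
    Adeg K (k - k % 2 ^ p - 2 ^ p) * U p * Adeg K (k % 2 ^ p)

/-- The Capelli polynomial
`d_n(x_1,…,x_n; y_1,…,y_n) = Σ_{σ ∈ Sym(n)} sgn(σ) x_{σ(1)} y_1 x_{σ(2)} y_2 ⋯ x_{σ(n)} y_n`,
evaluated in a ring. -/
def capelli {R : Type*} [Ring R] (n : ℕ) (x y : Fin n → R) : R :=
  ∑ σ : Equiv.Perm (Fin n),
    (Equiv.Perm.sign σ : ℤ) • ((List.finRange n).map fun i => x (σ i) * y i).prod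

/-- The quotient map `R → R ⧸ c` (for a ring congruence `c`) as a `K`-linear map. -/
def mkLin {R : Type*} [Semiring R] [Algebra K R] (c : RingCon R) :
    R →ₗ[K] c.Quotient where
  toFun := RingCon.toQuotient
  map_add' _ _ := rfl
  map_smul' _ _ := rfl

/-- A two-sided ideal of the free algebra is homogeneous iff it is spanned by its
homogeneous elements. -/
def IsHomogTSI (J : TwoSidedIdeal (FA K)) : Prop :=
  (J : Set (FA K)) ⊆ ↑(Submodule.span K {a : FA K | a ∈ J ∧ ∃ n, a ∈ Adeg K n})

/-- `S = ⋃_{n ∈ Y} {n - e(n) - 1, …, n - 1}`. -/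
def SetS (Y : Set ℕ) (e : ℕ → ℕ) : Set ℕ :=
  ⋃ n ∈ Y, Set.Icc (n - e n - 1) (n - 1)

/-- Conditions (1)-(8) of Theorem 4.1 of the paper, at index `m`, for the families
`F(2^m)`, `U(2^m)`, `V(2^m)` of subspaces of `A(2^m)`:
(1) `dim V(2^m) = 2` if `m ∉ S` and (in case `Y` is finite) `m ≤ max Y`;
(2) `dim V(2^{k-e(k)-1+j}) = 2^{2^j}` for all `k ∈ Y` and `0 ≤ j ≤ e(k)`;
(3) `V(2^m)` is spanned by monomials;
(4) `F(2^m) ⊆ U(2^m)` for `m ∈ Y`, and `F(2^m) = 0` for `m ∉ Y`;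
(5) `V(2^m) ⊕ U(2^m) = A(2^m)`;
(6) `A(2^{m-1})U(2^{m-1}) + U(2^{m-1})A(2^{m-1}) ⊆ U(2^m)`;
(7) `V(2^m) ⊆ V(2^{m-1})V(2^{m-1})`;
(8) if `Y` is finite and `m > max Y`, then `dim V(2^m) = 1`. -/
def Conds (Y : Set ℕ) (e : ℕ → ℕ) (F U V : ℕ → Submodule K (FA K)) (m : ℕ) : Prop :=
  (m ∉ SetS Y e → (Y.Finite → ∃ k ∈ Y, m ≤ k) → Module.finrank K (V m) = 2) ∧
  (∀ k ∈ Y, ∀ j ≤ e k, k - e k - 1 + j = m → Module.finrank K (V m) = 2 ^ 2 ^ j) ∧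
  (∃ s ⊆ Mon K (2 ^ m), V m = Submodule.span K s) ∧
  (m ∈ Y → F m ≤ U m) ∧ (m ∉ Y → F m = ⊥) ∧
  U m ≤ Adeg K (2 ^ m) ∧
  V m ⊔ U m = Adeg K (2 ^ m) ∧ V m ⊓ U m = ⊥ ∧
  (Adeg K (2 ^ (m - 1)) * U (m - 1) ⊔ U (m - 1) * Adeg K (2 ^ (m - 1)) ≤ U m) ∧
  V m ≤ V (m - 1) * V (m - 1) ∧
  (Y.Finite → (∀ k ∈ Y, k < m) → Module.finrank K (V m) = 1)

/-- The algebra map `a ↦ ∑ k, a_k T^k`, where `a_k` is the degree-`k` component of `a`. -/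
def gradingHom : FA K →ₐ[K] Polynomial (FA K) :=
  FreeAlgebra.lift K fun i => Polynomial.monomial 1 (FreeAlgebra.ι K i)

/-- The projection of the free algebra onto its homogeneous component of degree `k`. -/
def homogProj (k : ℕ) : FA K →ₗ[K] FA K :=
  ((Polynomial.lcoeff (FA K) k).restrictScalars K) ∘ₗ (gradingHom K).toLinearMap

lemma gradingHom_word (w : List (Fin 2)) :
    gradingHom K (w.map (FreeAlgebra.ι K)).prod =
      Polynomial.monomial w.length (w.map (FreeAlgebra.ι K)).prod := by
  induction w with
  | nil => simp
  | cons i w ih =>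
    rw [List.map_cons, List.prod_cons, map_mul, ih, List.length_cons, add_comm,
      ← Polynomial.monomial_mul_monomial]
    simp [gradingHom]

lemma homogProj_word (k : ℕ) (w : List (Fin 2)) :
    homogProj K k (w.map (FreeAlgebra.ι K)).prod =
      if w.length = k then (w.map (FreeAlgebra.ι K)).prod else 0 := by
  simp [homogProj, gradingHom_word, Polynomial.coeff_monomial]

lemma homogProj_of_mem_Adeg (k l : ℕ) {a : FA K} (ha : a ∈ Adeg K l) :
    homogProj K k a = if l = k then a else 0 := by
  induction ha using Submodule.span_induction with
  | mem a ha =>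
    obtain ⟨w, rfl, rfl⟩ := ha
    exact homogProj_word K k w
  | zero => simp
  | add a b _ _ iha ihb => rw [map_add, iha, ihb]; split_ifs <;> simp
  | smul c a _ iha => rw [map_smul, iha]; split_ifs <;> simp

lemma span_words_eq_top :
    Submodule.span K (Set.range fun w : List (Fin 2) => (w.map (FreeAlgebra.ι K)).prod) = ⊤ := by
  refine eq_top_iff.2 fun a _ => ?_
  induction a using FreeAlgebra.induction with
  | grade0 r =>
    rw [Algebra.algebraMap_eq_smul_one]
    exact Submodule.smul_mem _ _ (Submodule.subset_span ⟨[], by simp⟩)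
  | grade1 i => exact Submodule.subset_span ⟨[i], by simp⟩
  | add a b ha hb => exact Submodule.add_mem _ (ha trivial) (hb trivial)
  | mul a b ha hb =>
    have h := Submodule.mul_mem_mul (ha trivial) (hb trivial)
    rw [Submodule.span_mul_span] at h
    refine Submodule.span_mono ?_ h
    rintro _ ⟨_, ⟨v, rfl⟩, _, ⟨w, rfl⟩, rfl⟩
    exact ⟨v ++ w, by simp⟩

lemma Adeg_zero : Adeg K 0 = 1 := by
  have : Mon K 0 = {1} := by
    ext a
    constructor
    · rintro ⟨w, hw, rfl⟩
      simp [List.length_eq_zero_iff.1 hw]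
    · rintro rfl
      exact ⟨[], by simp⟩
  rw [Adeg, this, Submodule.one_eq_span]

lemma Adeg_mul_Adeg_le (k l : ℕ) : Adeg K k * Adeg K l ≤ Adeg K (k + l) := by
  rw [Adeg, Adeg, Submodule.span_mul_span]
  refine Submodule.span_mono ?_
  rintro _ ⟨_, ⟨v, rfl, rfl⟩, _, ⟨w, rfl, rfl⟩, rfl⟩
  exact ⟨v ++ w, by simp⟩

lemma pow_le_Adeg {W : Submodule K (FA K)} {d : ℕ} (hW : W ≤ Adeg K d) (j : ℕ) :
    W ^ j ≤ Adeg K (d * j) := by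
  induction j with
  | zero => simp [Adeg_zero]
  | succ j ih =>
    rw [pow_succ]
    exact (mul_le_mul' ih hW).trans (Adeg_mul_Adeg_le K _ _)

lemma lift_word_mem_pow {W : Submodule K (FA K)} {f : Fin 2 → FA K} (hf : ∀ i, f i ∈ W)
    (w : List (Fin 2)) :
    FreeAlgebra.lift K f (w.map (FreeAlgebra.ι K)).prod ∈ W ^ w.length := by
  induction w with
  | nil => simp
  | cons i w ih =>
    rw [List.map_cons, List.prod_cons, map_mul, List.length_cons, pow_succ']
    exact Submodule.mul_mem_mul (by simpa using hf i) ih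

lemma lift_homogProj_mem_pow {W : Submodule K (FA K)} {f : Fin 2 → FA K} (hf : ∀ i, f i ∈ W)
    (j : ℕ) (a : FA K) : FreeAlgebra.lift K f (homogProj K j a) ∈ W ^ j := by
  have ha : a ∈ Submodule.span K
      (Set.range fun w : List (Fin 2) => (w.map (FreeAlgebra.ι K)).prod) := by
    rw [span_words_eq_top]; trivial
  induction ha using Submodule.span_induction with
  | mem a ha =>
    obtain ⟨w, rfl⟩ := ha
    rw [homogProj_word]
    split_ifs with h
    · exact h ▸ lift_word_mem_pow K hf w
    · simp
  | zero => simp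
  | add a b _ _ iha ihb => rw [map_add, map_add]; exact add_mem iha ihb
  | smul c a _ iha => rw [map_smul, map_smul]; exact Submodule.smul_mem _ _ iha

/-- Substituting elements of degree `d` for the generators multiplies degrees by `d`. -/
lemma homogProj_mul_lift {d : ℕ} (hd : d ≠ 0) {f : Fin 2 → FA K} (hf : ∀ i, f i ∈ Adeg K d)
    (j : ℕ) (a : FA K) :
    homogProj K (d * j) (FreeAlgebra.lift K f a) = FreeAlgebra.lift K f (homogProj K j a) := by
  have ha : a ∈ Submodule.span K
      (Set.range fun w : List (Fin 2) => (w.map (FreeAlgebra.ι K)).prod) := by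
    rw [span_words_eq_top]; trivial
  induction ha using Submodule.span_induction with
  | mem a ha =>
    obtain ⟨w, rfl⟩ := ha
    dsimp only
    rw [homogProj_word, homogProj_of_mem_Adeg K (d * j) (d * w.length)
      (pow_le_Adeg K le_rfl _ (lift_word_mem_pow K hf w))]
    by_cases h : w.length = j <;> simp [h, hd]
  | zero => simp
  | add a b _ _ iha ihb => simp only [map_add, iha, ihb]
  | smul c a _ iha => simp only [map_smul, iha]

lemma eq_zero_of_forall_homogProj {a : FA K} (h : ∀ k, homogProj K k a = 0) : a = 0 := by
  have h0 : gradingHom K a = 0 := Polynomial.ext fun k => h k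
  let s : Polynomial (FA K) →ₗ[K] FA K :=
    (Polynomial.lsum fun _ => LinearMap.id (R := FA K)).restrictScalars K
  have hs : s ∘ₗ (gradingHom K).toLinearMap = LinearMap.id := by
    refine LinearMap.ext_on_range (span_words_eq_top K) fun w => ?_
    simp [s, gradingHom_word, Polynomial.lsum_apply]
  simpa [h0] using (LinearMap.congr_fun hs a).symm

lemma flatMap_injective_of_length_eq {α β : Type*} {u : α → List β} {d : ℕ} (hd : d ≠ 0)
    (hlen : ∀ a, (u a).length = d) (hu : Function.Injective u) :
    Function.Injective fun w : List α => w.flatMap u := by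
  intro v
  induction v with
  | nil =>
    rintro (_ | ⟨b, w⟩) h
    · rfl
    · have := congrArg List.length h
      simp [hlen] at this
      omega
  | cons a v ih =>
    rintro (_ | ⟨b, w⟩) h
    · have := congrArg List.length h
      simp [hlen] at this
      omega
    · simp only [List.flatMap_cons] at h
      obtain ⟨h1, h2⟩ := List.append_inj h (by rw [hlen, hlen])
      rw [hu h1, ih h2]

/-- Distinct words of the same positive length generate a free subalgebra. -/
lemma lift_words_injective {d : ℕ} (hd : d ≠ 0) {u : Fin 2 → List (Fin 2)}
    (hlen : ∀ i, (u i).length = d) (hu : Function.Injective u) :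
    Function.Injective
      (FreeAlgebra.lift K fun i => ((u i).map (FreeAlgebra.ι K)).prod : FA K →ₐ[K] FA K) := by
  let g : FreeMonoid (Fin 2) →* FreeMonoid (Fin 2) :=
    FreeMonoid.lift fun i => FreeMonoid.ofList (u i)
  have hg : Function.Injective g := by
    have : ∀ w, g w = FreeMonoid.ofList (w.toList.flatMap u) := fun w => by
      induction w using FreeMonoid.recOn with
      | one => simp
      | of_mul i w ih => simp [g, ih]
    intro v w h
    rw [this, this] at h
    exact flatMap_injective_of_length_eq hd hlen hu h
  let e : FA K ≃ₐ[K] MonoidAlgebra K (FreeMonoid (Fin 2)) :=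
    FreeAlgebra.equivMonoidAlgebraFreeMonoid
  have he : ∀ w : List (Fin 2), e (w.map (FreeAlgebra.ι K)).prod =
      MonoidAlgebra.of K _ (FreeMonoid.ofList w) := by
    intro w
    induction w with
    | nil => simp [MonoidAlgebra.one_def]
    | cons i w ih =>
      rw [List.map_cons, List.prod_cons, map_mul, ih, FreeMonoid.ofList_cons, map_mul]
      simp [e, FreeAlgebra.equivMonoidAlgebraFreeMonoid]
  have hcomp : e.toAlgHom.comp
      (FreeAlgebra.lift K fun i => ((u i).map (FreeAlgebra.ι K)).prod : FA K →ₐ[K] FA K) =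
      (MonoidAlgebra.mapDomainAlgHom K K g).comp e.toAlgHom := by
    refine FreeAlgebra.hom_ext (funext fun i => ?_)
    have h1 := he (u i)
    have h2 := he [i]
    simp only [List.map_cons, List.map_nil, List.prod_cons, List.prod_nil, mul_one] at h2
    simp [h1, h2, g]
  intro a b hab
  have h := congrArg e hab
  have hc := fun a => DFunLike.congr_fun hcomp a
  refine e.injective (MonoidAlgebra.mapDomain_injective (R := K) hg ?_)
  exact (hc a).symm.trans (h.trans (hc b))

/-- Multiplying the degree-`k` component of an element of `E` up to degree `2^(N+1)`, where
`2^(N-1) ≤ k < 2^N`, gives an element of `U(2^N)A(2^N) + A(2^N)U(2^N)`. -/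
lemma homogProj_mul_mem_of_mem_Esub (U : ℕ → Submodule K (FA K)) {k l : ℕ}
    (hkl : k + l = 2 ^ (Nat.log 2 k + 2)) {b : FA K} (hb : b ∈ Adeg K l)
    {a : FA K} (ha : a ∈ Esub K U) :
    homogProj K k a * b ∈ U (Nat.log 2 k + 1) * Adeg K (2 ^ (Nat.log 2 k + 1)) ⊔
      Adeg K (2 ^ (Nat.log 2 k + 1)) * U (Nat.log 2 k + 1) := by
  induction ha using Submodule.span_induction with
  | mem a ha =>
    obtain ⟨i, -, hi, hE⟩ := by simpa only [Set.mem_iUnion, exists_prop] using ha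
    rw [homogProj_of_mem_Adeg K k i hi]
    split_ifs with h
    · subst h
      refine hE ⟨Submodule.mul_mem_mul ?_ trivial, ?_⟩
      · simpa using Submodule.mul_mem_mul (Submodule.mem_top (x := (1 : FA K)))
          (Submodule.mem_span_singleton_self (R := K) a)
      · exact hkl ▸ Adeg_mul_Adeg_le K _ _ (Submodule.mul_mem_mul hi hb)
    · simp
  | zero => simp
  | add a b _ _ iha ihb => rw [map_add, add_mul]; exact add_mem iha ihb
  | smul c a _ iha => rw [map_smul, smul_mul_assoc]; exact Submodule.smul_mem _ _ iha

lemma homogProj_zero_of_mem_Esub (U : ℕ → Submodule K (FA K)) {a : FA K}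
    (ha : a ∈ Esub K U) : homogProj K 0 a = 0 := by
  induction ha using Submodule.span_induction with
  | mem a ha =>
    obtain ⟨i, hi, ha, -⟩ := by simpa only [Set.mem_iUnion, exists_prop] using ha
    have hi : 1 ≤ i := hi
    rw [homogProj_of_mem_Adeg K 0 i ha, if_neg (by omega)]
  | zero => simp
  | add a b _ _ iha ihb => rw [map_add, iha, ihb, add_zero]
  | smul c a _ iha => rw [map_smul, iha, smul_zero]

lemma eq_pow_of_succ_eq_mul_self {V : ℕ → Submodule K (FA K)} {n : ℕ}
    (hprod : ∀ m, n ≤ m → V (m + 1) = V m * V m) (p : ℕ) : V (n + p) = V n ^ 2 ^ p := by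
  induction p with
  | zero => simp
  | succ p ih => rw [← add_assoc, hprod _ (by omega), ih, pow_succ 2, mul_two, pow_add]

/-- **Theorem 1.2.**  If `dim V(2^n) = 2`, say `V(2^n) = K·m₁ + K·m₂` with `m₁, m₂`
monomials of degree `2^n`, and `V(2^{m+1}) = V(2^m)V(2^m)` for all `m ≥ n`, then the
images of `m₁, m₂` in `A/E` generate a free subalgebra (i.e. the composite of the algebra
map `K⟨X,Y⟩ → A`, `X ↦ m₁`, `Y ↦ m₂`, with the quotient map `A → A/E` is injective). -/
theorem statement4 (U V : ℕ → Submodule K (FA K)) (hUV : UVCond K U V)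
    (n : ℕ) (hn : 1 ≤ n) (hVdim : Module.finrank K (V n) = 2)
    (m₁ m₂ : FA K) (hm₁ : m₁ ∈ Mon K (2 ^ n)) (hm₂ : m₂ ∈ Mon K (2 ^ n))
    (hV : V n = Submodule.span K {m₁, m₂})
    (hprod : ∀ m, n ≤ m → V (m + 1) = V m * V m) :
    Function.Injective
      ((Esub K U).mkQ ∘ₗ
        (FreeAlgebra.lift K ![m₁, m₂] : FreeAlgebra K (Fin 2) →ₐ[K] FA K).toLinearMap) := by
  obtain ⟨u₁, hu₁, rfl⟩ := hm₁
  obtain ⟨u₂, hu₂, rfl⟩ := hm₂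
  have hd : 2 ^ n ≠ 0 := by positivity
  have hne : u₁ ≠ u₂ := by
    rintro rfl
    have := finrank_span_finset_le_card (R := K) {(u₁.map (FreeAlgebra.ι K)).prod}
    rw [Finset.coe_singleton, Finset.card_singleton, Set.finrank] at this
    rw [hV, Set.pair_eq_singleton] at hVdim
    exact absurd (hVdim.symm.le.trans this) (by norm_num)
  set f : Fin 2 → FA K := ![(u₁.map (FreeAlgebra.ι K)).prod, (u₂.map (FreeAlgebra.ι K)).prod]
    with hf
  have hfeq : f = fun i => ((![u₁, u₂] i).map (FreeAlgebra.ι K)).prod := by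
    funext i; fin_cases i <;> rfl
  have hinj : Function.Injective (FreeAlgebra.lift K f) := by
    rw [hfeq]
    refine lift_words_injective K hd (fun i => ?_) fun i j hij => ?_
    · fin_cases i <;> assumption
    · fin_cases i <;> fin_cases j <;> simp_all
  have hfV : ∀ i, f i ∈ V n := by
    intro i
    rw [hV]
    fin_cases i <;> exact Submodule.subset_span (by simp [hf])
  have hVA : V n ≤ Adeg K (2 ^ n) := by
    rw [hV]
    refine Submodule.span_mono ?_
    rintro _ (rfl | rfl)
    exacts [⟨u₁, hu₁, rfl⟩, ⟨u₂, hu₂, rfl⟩]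
  have hf0 : f 0 ≠ 0 := by
    intro h
    refine FreeAlgebra.ι_ne_zero (R := K) (0 : Fin 2) (hinj ?_)
    rw [FreeAlgebra.lift_ι_apply, h, map_zero]
  refine (injective_iff_map_eq_zero _).2 fun a ha => ?_
  have ha : FreeAlgebra.lift K f a ∈ Esub K U := by simpa using ha
  refine eq_zero_of_forall_homogProj K fun j => hinj ?_
  rw [map_zero]
  have hcomm := homogProj_mul_lift K hd (fun i => hVA (hfV i)) j a
  rcases Nat.eq_zero_or_pos j with rfl | hj
  · rw [← hcomm, mul_zero, homogProj_zero_of_mem_Esub K U ha]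
  set N := Nat.log 2 (2 ^ n * j) with hN
  have hnN : n ≤ N :=
    Nat.le_log_of_pow_le one_lt_two (Nat.le_mul_of_pos_right _ hj)
  obtain ⟨p, hp⟩ := Nat.exists_eq_add_of_le hnN
  have hsplit : 2 ^ (N + 2) = 2 ^ n * 2 ^ (p + 2) := by rw [hp, ← pow_add, add_assoc]
  have hlt : 2 ^ n * j < 2 ^ n * 2 ^ (p + 2) := by
    rw [← hsplit]
    exact (Nat.lt_pow_succ_log_self one_lt_two _).trans
      (Nat.pow_lt_pow_right one_lt_two (by omega))
  obtain ⟨i, hi⟩ := Nat.exists_eq_add_of_le (Nat.lt_of_mul_lt_mul_left hlt).le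
  have hpow : f 0 ^ i ∈ V n ^ i := Submodule.pow_mem_pow _ (hfV 0) i
  have hmemU := homogProj_mul_mem_of_mem_Esub K U (k := 2 ^ n * j) (l := 2 ^ n * i)
    (by rw [← hN, hsplit, hi, mul_add]) (pow_le_Adeg K hVA i hpow) ha
  rw [hcomm, ← hN] at hmemU
  have hmemV : FreeAlgebra.lift K f (homogProj K j a) * f 0 ^ i ∈ V (N + 2) := by
    rw [hp, add_assoc, eq_pow_of_succ_eq_mul_self K hprod, hi, pow_add]
    exact Submodule.mul_mem_mul (lift_homogProj_mem_pow K hfV j a) hpow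
  obtain ⟨-, -, -, hdisj, hU, -⟩ := hUV.2.2 (N + 2) (by omega)
  have hzero : FreeAlgebra.lift K f (homogProj K j a) * f 0 ^ i = 0 := by
    rw [← Submodule.mem_bot K, ← hdisj]
    exact ⟨hmemV, hU (by rw [sup_comm]; exact hmemU)⟩
  exact (mul_eq_zero.1 hzero).resolve_right (pow_ne_zero _ hf0)

end
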